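/- Suppose that under q, H(Y¹ | X²) = 0 and H(Y² | X¹) = 0 (i.e., Y¹ is a deterministic function of X² and Y² is a deterministic function of X¹). Then every rate pair (R₁₂, R₂₁) with R₁₂ > H_q(Y² | X²) and R₂₁ > H_q(Y¹ | X¹) is admissible for q with 2 interactive rounds of communication. -/

import Mathlib

open scoped BigOperators
open Finset

noncomputable section

namespace Coord

variable {Ω α β γ : Type*}

/-- `p` is a probability mass function on the finite type `α`. -/
def IsPMF [Fintype α] (p : α → ℝ) : Prop := (∀ a, 0 ≤ p a) ∧ ∑ a, p a = 1

/-- ℓ¹ (total variation) distance between two functions on a finite type. -/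
def l1dist [Fintype α] (p q : α → ℝ) : ℝ := ∑ a, |p a - q a|

/-- The distribution (pushforward pmf) of the random variable `X` defined on the
finite sample space `Ω` carrying the pmf `μ`. -/
def distr [Fintype Ω] [DecidableEq α] (μ : Ω → ℝ) (X : Ω → α) : α → ℝ :=
  fun a => ∑ ω, if X ω = a then μ ω else 0

/-- Shannon entropy (base 2) of a pmf. -/
def entFun [Fintype α] (p : α → ℝ) : ℝ := - ∑ a, p a * Real.logb 2 (p a)

/-- Shannon entropy `H(X)` of a random variable `X` on `(Ω, μ)`. -/
def H [Fintype Ω] [Fintype α] [DecidableEq α] (μ : Ω → ℝ) (X : Ω → α) : ℝ :=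
  entFun (distr μ X)

/-- Conditional entropy `H(X | Z)`. -/
def condEnt [Fintype Ω] [Fintype α] [Fintype γ] [DecidableEq α] [DecidableEq γ]
    (μ : Ω → ℝ) (X : Ω → α) (Z : Ω → γ) : ℝ :=
  H μ (fun ω => (X ω, Z ω)) - H μ Z

/-- Mutual information `I(X; Y)`. -/
def mi [Fintype Ω] [Fintype α] [Fintype β] [DecidableEq α] [DecidableEq β]
    (μ : Ω → ℝ) (X : Ω → α) (Y : Ω → β) : ℝ :=
  H μ X + H μ Y - H μ (fun ω => (X ω, Y ω))

/-- Conditional mutual information `I(X; Y | Z)`. -/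
def cmi [Fintype Ω] [Fintype α] [Fintype β] [Fintype γ]
    [DecidableEq α] [DecidableEq β] [DecidableEq γ]
    (μ : Ω → ℝ) (X : Ω → α) (Y : Ω → β) (Z : Ω → γ) : ℝ :=
  H μ (fun ω => (X ω, Z ω)) + H μ (fun ω => (Y ω, Z ω))
    - H μ (fun ω => (X ω, Y ω, Z ω)) - H μ Z

variable {𝒳₁ 𝒳₂ 𝒴₁ 𝒴₂ : Type}

/-- The `(x¹, x²)`-marginal of `q(x¹, x², y¹, y²)`. -/
def srcMarg [Fintype 𝒴₁] [Fintype 𝒴₂] (q : 𝒳₁ × 𝒳₂ × 𝒴₁ × 𝒴₂ → ℝ) :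
    𝒳₁ × 𝒳₂ → ℝ := fun x => ∑ y₁, ∑ y₂, q (x.1, x.2, y₁, y₂)

/-- The rate pair `(R12, R21)` is admissible for the coordination problem `q` with `r`
interactive rounds of communication: for every `ε > 0`, for all large enough block
lengths `n`, there is a finite probability space carrying the i.i.d. sources, private
randomness `M₁, M₂`, interactive messages `C i` (messages with even Lean-index,
i.e. odd 1-based index, are sent by the first node), and outputs `Y₁, Y₂`,
meeting the rate constraints and approximating the i.i.d. target distribution
within total variation `ε`. -/
def Admissible [Fintype 𝒳₁] [Fintype 𝒳₂] [Fintype 𝒴₁] [Fintype 𝒴₂]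
    [DecidableEq 𝒳₁] [DecidableEq 𝒳₂] [DecidableEq 𝒴₁] [DecidableEq 𝒴₂]
    (q : 𝒳₁ × 𝒳₂ × 𝒴₁ × 𝒴₂ → ℝ) (r : ℕ) (R12 R21 : ℝ) : Prop :=
  ∀ ε : ℝ, 0 < ε → ∃ n₀ : ℕ, ∀ n : ℕ, n₀ ≤ n →
    ∃ (Ω 𝓜₁ 𝓜₂ : Type) (𝓒 : Fin r → Type)
      (_ : Fintype Ω) (_ : DecidableEq Ω)
      (_ : Fintype 𝓜₁) (_ : DecidableEq 𝓜₁)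
      (_ : Fintype 𝓜₂) (_ : DecidableEq 𝓜₂)
      (_ : ∀ i, Fintype (𝓒 i)) (_ : ∀ i, DecidableEq (𝓒 i))
      (μ : Ω → ℝ)
      (X₁ : Ω → Fin n → 𝒳₁) (X₂ : Ω → Fin n → 𝒳₂)
      (M₁ : Ω → 𝓜₁) (M₂ : Ω → 𝓜₂)
      (C : (i : Fin r) → Ω → 𝓒 i)
      (Y₁ : Ω → Fin n → 𝒴₁) (Y₂ : Ω → Fin n → 𝒴₂),
      IsPMF μ ∧
      -- the source pairs are i.i.d. with per-letter distribution the (x¹,x²)-marginal of q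
      (distr μ (fun ω => (X₁ ω, X₂ ω)) =
        fun x => ∏ k, srcMarg q (x.1 k, x.2 k)) ∧
      -- M₁, M₂ and the sources are mutually independent
      (distr μ (fun ω => (M₁ ω, M₂ ω, X₁ ω, X₂ ω)) =
        fun m => distr μ M₁ m.1 * distr μ M₂ m.2.1 *
          distr μ (fun ω => (X₁ ω, X₂ ω)) m.2.2) ∧
      -- messages with odd 1-based index are functions of (previous messages, X¹, M₁)
      (∀ i : Fin r, (i : ℕ) % 2 = 0 →
        condEnt μ (C i)
          (fun ω => ((fun j : Fin (i : ℕ) => C ⟨j.1, j.2.trans i.2⟩ ω), X₁ ω, M₁ ω)) = 0) ∧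
      -- messages with even 1-based index are functions of (previous messages, X², M₂)
      (∀ i : Fin r, (i : ℕ) % 2 = 1 →
        condEnt μ (C i)
          (fun ω => ((fun j : Fin (i : ℕ) => C ⟨j.1, j.2.trans i.2⟩ ω), X₂ ω, M₂ ω)) = 0) ∧
      -- rate constraints
      (∑ i ∈ Finset.univ.filter (fun i : Fin r => (i : ℕ) % 2 = 0), H μ (C i)) ≤ n * R12 ∧
      (∑ i ∈ Finset.univ.filter (fun i : Fin r => (i : ℕ) % 2 = 1), H μ (C i)) ≤ n * R21 ∧
      -- the outputs are produced from the locally available information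
      condEnt μ Y₁ (fun ω => (X₁ ω, M₁ ω, fun i : Fin r => C i ω)) = 0 ∧
      condEnt μ Y₂ (fun ω => (X₂ ω, M₂ ω, fun i : Fin r => C i ω)) = 0 ∧
      -- total variation distance to the i.i.d. target is at most ε
      l1dist (distr μ (fun ω => (X₁ ω, X₂ ω, Y₁ ω, Y₂ ω)))
        (fun a => ∏ k, q (a.1 k, a.2.1 k, a.2.2.1 k, a.2.2.2 k)) ≤ ε

section Binning

/-- The functions that collide at two given distinct points make up at most a fraction `1 / K`
of all functions into `Fin K`. -/
lemma card_collision_mul_le {T : Type*} [Fintype T] [DecidableEq T] {K : ℕ} {v v' : T}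
    (hv : v' ≠ v) :
    #{h : T → Fin K | h v' = h v} * K ≤ Fintype.card (T → Fin K) := by
  have key : #(({h : T → Fin K | h v' = h v} : Finset (T → Fin K)) ×ˢ (univ : Finset (Fin K)))
      ≤ #(univ : Finset (T → Fin K)) := by
    apply Finset.card_le_card_of_injOn (fun p => Function.update p.1 v' p.2)
    · intro p _
      simp
    · rintro ⟨h, c⟩ hh ⟨h', c'⟩ hh' heq
      simp only [coe_product, coe_filter, mem_univ, true_and, coe_univ, Set.mem_prod,
        Set.mem_ofPred_eq, Set.mem_univ, and_true] at hh hh'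
      have e : ∀ u, Function.update h v' c u = Function.update h' v' c' u := fun u =>
        congrFun heq u
      have hc : c = c' := by simpa using e v'
      have hu : ∀ u, u ≠ v' → h u = h' u := fun u hu => by simpa [hu] using e u
      refine Prod.ext (funext fun u => ?_) hc
      by_cases h1 : u = v'
      · subst h1
        exact hh.trans ((hu v hv.symm).trans hh'.symm)
      · exact hu u h1
  simpa [card_product] using key

lemma exists_max_likelihood_decoder {S T B : Type*} [Fintype T] [Nonempty T] (w : S → T → ℝ)
    (h : T → B) :
    ∃ D : S → B → T, ∀ s v, D s (h v) ≠ v →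
      ∃ v', v' ≠ v ∧ h v' = h v ∧ w s v ≤ w s v' := by
  classical
  have : ∀ s c, ∃ d : T, ∀ v, h v = c → h d = c ∧ w s v ≤ w s d := by
    intro s c
    by_cases hne : ({v | h v = c} : Finset T).Nonempty
    · obtain ⟨d, hd, hmax⟩ := exists_max_image _ (w s) hne
      exact ⟨d, fun v hv => ⟨by simpa using hd, hmax v (by simpa using hv)⟩⟩
    · refine ⟨Classical.arbitrary T, fun v hv => ?_⟩
      exact absurd ⟨v, by simpa using hv⟩ hne
  choose D hD using this
  exact ⟨D, fun s v hne => ⟨D s (h v), hne, hD s (h v) v rfl⟩⟩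

lemma le_rpow_of_le_one_of_le {x u t : ℝ} (h1 : x ≤ 1) (hu : x ≤ u) (hu0 : 0 < u) (ht0 : 0 ≤ t)
    (ht1 : t ≤ 1) : x ≤ u ^ t := by
  rcases le_total 1 u with h | h
  · exact h1.trans (Real.one_le_rpow h ht0)
  · refine hu.trans ?_
    simpa using Real.rpow_le_rpow_of_exponent_ge hu0 h ht1

/-- Gallager-type bound on the proportion of binnings for which some competitor of `v`
that is at least as likely falls into the bin of `v`. -/
lemma card_confusion_le {T : Type*} [Fintype T] [DecidableEq T] {K : ℕ} (hK : 0 < K)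
    (w : T → ℝ) (hw : ∀ v, 0 ≤ w v) (hw1 : ∑ v, w v ≤ 1) {v : T} (hv : 0 < w v)
    {t : ℝ} (ht0 : 0 ≤ t) (ht1 : t ≤ 1) :
    (#{h : T → Fin K | ∃ v', v' ≠ v ∧ h v' = h v ∧ w v ≤ w v'} : ℝ) ≤
      Fintype.card (T → Fin K) * (1 / (K * w v)) ^ t := by
  set N : ℕ := Fintype.card (T → Fin K) with hN
  set E : Finset (T → Fin K) := {h | ∃ v', v' ≠ v ∧ h v' = h v ∧ w v ≤ w v'} with hE
  set L : Finset T := {v' | v' ≠ v ∧ w v ≤ w v'} with hL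
  have : Nonempty (Fin K) := ⟨⟨0, hK⟩⟩
  have hNpos : (0 : ℝ) < N := by exact_mod_cast Fintype.card_pos
  have hKpos : (0 : ℝ) < K := by exact_mod_cast hK
  have hEN : (#E : ℝ) ≤ N := by exact_mod_cast card_le_univ E
  have hLw : (#L : ℝ) * w v ≤ 1 := by
    rw [← nsmul_eq_mul]
    refine (card_nsmul_le_sum L w (w v) fun v' h' => ?_).trans
      ((sum_le_univ_sum_of_nonneg hw).trans hw1)
    simp only [hL, mem_filter] at h'
    exact h'.2.2
  have hEL : #E * K ≤ #L * N := by
    have hsub : E ⊆ L.biUnion fun v' => {h : T → Fin K | h v' = h v} := by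
      intro h hh
      simp only [hE, mem_filter, mem_univ, true_and] at hh
      obtain ⟨v', h1, h2, h3⟩ := hh
      simp only [mem_biUnion, hL, mem_filter, mem_univ, true_and]
      exact ⟨v', ⟨h1, h3⟩, h2⟩
    calc #E * K ≤ (∑ v' ∈ L, #{h : T → Fin K | h v' = h v}) * K :=
          Nat.mul_le_mul_right _ ((card_le_card hsub).trans card_biUnion_le)
      _ = ∑ v' ∈ L, #{h : T → Fin K | h v' = h v} * K := sum_mul _ _ _
      _ ≤ ∑ _v' ∈ L, N := sum_le_sum fun v' h' => card_collision_mul_le (by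
          simp only [hL, mem_filter] at h'
          exact h'.2.1)
      _ = #L * N := by simp
  have hEL' : (#E : ℝ) * K ≤ #L * N := by exact_mod_cast hEL
  have hu : (#E : ℝ) / N ≤ 1 / (K * w v) := by
    rw [div_le_div_iff₀ hNpos (by positivity)]
    calc (#E : ℝ) * (K * w v) = (#E * K) * w v := by ring
      _ ≤ (#L * N) * w v := by gcongr
      _ = (#L * w v) * N := by ring
      _ ≤ 1 * N := by gcongr
  have := le_rpow_of_le_one_of_le ((div_le_one hNpos).2 hEN) hu (by positivity) ht0 ht1
  rw [div_le_iff₀ hNpos] at this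
  linarith

/-- One-shot random binning with side information. -/
lemma exists_binning {A S T : Type*} [Fintype A] [Fintype T] [DecidableEq T] [Nonempty T]
    (P : A → ℝ) (hP : ∀ a, 0 ≤ P a) (U : A → S) (V : A → T) (w : S → T → ℝ)
    (hw : ∀ s v, 0 ≤ w s v) (hw1 : ∀ s, ∑ v, w s v ≤ 1)
    (hpos : ∀ a, 0 < P a → 0 < w (U a) (V a)) {K : ℕ} (hK : 0 < K)
    {t : ℝ} (ht0 : 0 ≤ t) (ht1 : t ≤ 1) :
    ∃ (h : T → Fin K) (D : S → Fin K → T),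
      (∑ a, if D (U a) (h (V a)) = V a then 0 else P a) ≤
        ∑ a, P a * (1 / (K * w (U a) (V a))) ^ t := by
  choose D hD using fun h : T → Fin K => exists_max_likelihood_decoder w h
  have : Nonempty (Fin K) := ⟨⟨0, hK⟩⟩
  suffices hs : ∑ h : T → Fin K, (∑ a, if D h (U a) (h (V a)) = V a then 0 else P a) ≤
      ∑ _h : T → Fin K, ∑ a, P a * (1 / (K * w (U a) (V a))) ^ t by
    obtain ⟨h, -, hh⟩ := exists_le_of_sum_le univ_nonempty hs
    exact ⟨h, D h, hh⟩
  rw [sum_comm, sum_const, card_univ, nsmul_eq_mul, mul_sum]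
  refine sum_le_sum fun a _ => ?_
  rcases (hP a).eq_or_lt with h0 | h0
  · simp [← h0]
  have hc := card_confusion_le hK (w (U a)) (hw _) (hw1 _) (hpos a h0) ht0 ht1
  calc (∑ h : T → Fin K, if D h (U a) (h (V a)) = V a then 0 else P a)
      ≤ ∑ h : T → Fin K,
          if ∃ v', v' ≠ V a ∧ h v' = h (V a) ∧ w (U a) (V a) ≤ w (U a) v' then P a else 0 := by
        refine sum_le_sum fun h _ => ?_
        by_cases he : D h (U a) (h (V a)) = V a
        · rw [if_pos he]
          split_ifs <;> simp [h0.le]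
        · rw [if_neg he, if_pos (hD h _ _ he)]
    _ = #{h : T → Fin K | ∃ v', v' ≠ V a ∧ h v' = h (V a) ∧ w (U a) (V a) ≤ w (U a) v'}
          * P a := by
        rw [← sum_filter, sum_const, nsmul_eq_mul]
    _ ≤ Fintype.card (T → Fin K) * (1 / (K * w (U a) (V a))) ^ t * P a := by gcongr
    _ = _ := by ring

end Binning

section Entropy

variable {Ω α β γ : Type*} [Fintype Ω] [DecidableEq α] [DecidableEq β] [DecidableEq γ]

lemma distr_nonneg {μ : Ω → ℝ} (hμ : ∀ ω, 0 ≤ μ ω) (X : Ω → α) (a : α) : 0 ≤ distr μ X a :=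
  sum_nonneg fun ω _ => by split_ifs <;> simp [hμ]

lemma le_distr_self {μ : Ω → ℝ} (hμ : ∀ ω, 0 ≤ μ ω) (X : Ω → α) (ω : Ω) :
    μ ω ≤ distr μ X (X ω) := by
  have := single_le_sum (f := fun ω' => if X ω' = X ω then μ ω' else 0)
    (fun ω' _ => by split_ifs <;> simp [hμ]) (mem_univ ω)
  simpa [distr] using this

lemma sum_distr_mul [Fintype α] (μ : Ω → ℝ) (X : Ω → α) (f : α → ℝ) :
    ∑ a, distr μ X a * f a = ∑ ω, μ ω * f (X ω) := by
  simp only [distr, sum_mul, ite_mul, zero_mul]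
  rw [sum_comm]
  simp

lemma sum_distr [Fintype α] (μ : Ω → ℝ) (X : Ω → α) : ∑ a, distr μ X a = ∑ ω, μ ω := by
  simpa using sum_distr_mul μ X fun _ => 1

lemma sum_distr_pair [Fintype α] (μ : Ω → ℝ) (X : Ω → α) (Z : Ω → γ) (z : γ) :
    ∑ x, distr μ (fun ω => (X ω, Z ω)) (x, z) = distr μ Z z := by
  simp only [distr, Prod.mk.injEq]
  rw [sum_comm]
  refine sum_congr rfl fun ω _ => ?_
  by_cases h : Z ω = z <;> simp [h]

lemma distr_pair_le [Fintype α] {μ : Ω → ℝ} (hμ : ∀ ω, 0 ≤ μ ω) (X : Ω → α) (Z : Ω → γ)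
    (x : α) (z : γ) : distr μ (fun ω => (X ω, Z ω)) (x, z) ≤ distr μ Z z := by
  rw [← sum_distr_pair μ X Z z]
  exact single_le_sum (f := fun x => distr μ (fun ω => (X ω, Z ω)) (x, z))
    (fun _ _ => distr_nonneg hμ _ _) (mem_univ x)

lemma H_eq_sum [Fintype α] (μ : Ω → ℝ) (X : Ω → α) :
    H μ X = -∑ ω, μ ω * Real.logb 2 (distr μ X (X ω)) := by
  rw [H, entFun, sum_distr_mul μ X fun a => Real.logb 2 (distr μ X a)]

lemma condEnt_eq_sum [Fintype α] [Fintype γ] (μ : Ω → ℝ) (X : Ω → α) (Z : Ω → γ) :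
    condEnt μ X Z = ∑ ω, μ ω * (Real.logb 2 (distr μ Z (Z ω)) -
      Real.logb 2 (distr μ (fun ω => (X ω, Z ω)) (X ω, Z ω))) := by
  simp only [condEnt, H_eq_sum, mul_sub, sum_sub_distrib]
  ring

lemma condEnt_summand_nonneg [Fintype α] {μ : Ω → ℝ} (hμ : ∀ ω, 0 ≤ μ ω) (X : Ω → α)
    (Z : Ω → γ) (ω : Ω) :
    0 ≤ μ ω * (Real.logb 2 (distr μ Z (Z ω)) -
      Real.logb 2 (distr μ (fun ω => (X ω, Z ω)) (X ω, Z ω))) := by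
  rcases (hμ ω).eq_or_lt with h | h
  · simp [← h]
  · have h1 := h.trans_le (le_distr_self hμ (fun ω => (X ω, Z ω)) ω)
    exact mul_nonneg h.le (sub_nonneg.2
      (Real.logb_le_logb_of_le one_lt_two h1 (distr_pair_le hμ X Z _ _)))

lemma condEnt_nonneg [Fintype α] [Fintype γ] {μ : Ω → ℝ} (hμ : ∀ ω, 0 ≤ μ ω) (X : Ω → α)
    (Z : Ω → γ) : 0 ≤ condEnt μ X Z := by
  rw [condEnt_eq_sum]
  exact sum_nonneg fun ω _ => condEnt_summand_nonneg hμ X Z ω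

lemma condEnt_eq_zero_of_eq_comp [Fintype α] [Fintype γ] (μ : Ω → ℝ) {X : Ω → α} {Z : Ω → γ}
    (F : γ → α) (hF : ∀ ω, X ω = F (Z ω)) : condEnt μ X Z = 0 := by
  rw [condEnt_eq_sum]
  refine sum_eq_zero fun ω _ => ?_
  have : distr μ (fun ω => (X ω, Z ω)) (X ω, Z ω) = distr μ Z (Z ω) := by
    refine sum_congr rfl fun ω' _ => ?_
    by_cases h : Z ω' = Z ω <;> simp [hF, h]
  rw [this, sub_self, mul_zero]

lemma eq_of_condEnt_eq_zero [Fintype α] [Fintype γ] {μ : Ω → ℝ} (hμ : ∀ ω, 0 ≤ μ ω)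
    {X : Ω → α} {Z : Ω → γ} (h : condEnt μ X Z = 0) {ω ω' : Ω} (hω : 0 < μ ω) (hω' : 0 < μ ω')
    (hZ : Z ω = Z ω') : X ω = X ω' := by
  by_contra hne
  rw [condEnt_eq_sum, sum_eq_zero_iff_of_nonneg fun ω _ => condEnt_summand_nonneg hμ X Z ω] at h
  have h0 := h ω (mem_univ ω)
  have hp := hω.trans_le (le_distr_self hμ (fun ω => (X ω, Z ω)) ω)
  have hp' := hω'.trans_le (le_distr_self hμ (fun ω => (X ω, Z ω)) ω')
  have hz := hω.trans_le (le_distr_self hμ Z ω)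
  have heq := Real.logb_injOn_pos one_lt_two (Set.mem_Ioi.2 hz) (Set.mem_Ioi.2 hp)
    (sub_eq_zero.1 ((mul_eq_zero.1 h0).resolve_left hω.ne'))
  have hsum := sum_distr_pair μ X Z (Z ω)
  have hle := sum_le_univ_sum_of_nonneg (s := {X ω, X ω'})
    (f := fun x => distr μ (fun ω => (X ω, Z ω)) (x, Z ω)) (fun _ => distr_nonneg hμ _ _)
  rw [sum_pair hne, hsum] at hle
  rw [← hZ] at hp'
  linarith

/-- A random variable that is determined by `Z` is almost surely a function of `Z`. -/
lemma exists_fun_of_condEnt_eq_zero [Fintype α] [Fintype γ] [Nonempty α] {μ : Ω → ℝ}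
    (hμ : ∀ ω, 0 ≤ μ ω) {X : Ω → α} {Z : Ω → γ} (h : condEnt μ X Z = 0) :
    ∃ f : γ → α, ∀ ω, 0 < μ ω → X ω = f (Z ω) := by
  classical
  refine ⟨fun z => if hz : ∃ ω, 0 < μ ω ∧ Z ω = z then X hz.choose else Classical.arbitrary α,
    fun ω hω => ?_⟩
  have hz : ∃ ω', 0 < μ ω' ∧ Z ω' = Z ω := ⟨ω, hω, rfl⟩
  simp only [dif_pos hz]
  exact eq_of_condEnt_eq_zero hμ h hω hz.choose_spec.1 hz.choose_spec.2.symm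

lemma H_le_logb_card [Fintype α] {μ : Ω → ℝ} (hμ : IsPMF μ) (X : Ω → α) :
    H μ X ≤ Real.logb 2 (Fintype.card α) := by
  obtain ⟨ω₀⟩ : Nonempty Ω := by
    by_contra hne
    rw [not_nonempty_iff] at hne
    simpa using hμ.2
  have : Nonempty α := ⟨X ω₀⟩
  have hK : (0 : ℝ) < Fintype.card α := by exact_mod_cast Fintype.card_pos
  have hsum : ∑ a, distr μ X a = 1 := (sum_distr μ X).trans hμ.2
  have hlog : ∀ a, -(distr μ X a * Real.log (distr μ X a)) ≤
      distr μ X a * Real.log (Fintype.card α) + (1 / Fintype.card α - distr μ X a) := by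
    intro a
    rcases (distr_nonneg hμ.1 X a).eq_or_lt with h | h
    · rw [← h]
      simp
    · have := Real.log_le_sub_one_of_pos (x := 1 / (Fintype.card α * distr μ X a))
        (by positivity)
      rw [Real.log_div one_ne_zero (by positivity), Real.log_one,
        Real.log_mul hK.ne' h.ne'] at this
      have h2 := mul_le_mul_of_nonneg_left this h.le
      have h3 : distr μ X a * (1 / (Fintype.card α * distr μ X a) - 1) =
          1 / Fintype.card α - distr μ X a := by field_simp
      linarith
  have htot := sum_le_sum fun a (_ : a ∈ univ) => hlog a
  rw [sum_neg_distrib, sum_add_distrib, ← sum_mul, hsum, sum_sub_distrib, hsum, sum_const,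
    card_univ, nsmul_eq_mul, mul_one_div_cancel hK.ne'] at htot
  have hl2 := Real.log_pos one_lt_two
  simp only [H, entFun, Real.logb, mul_div_assoc', ← sum_div, ← neg_div]
  gcongr
  linarith

lemma ite_and_zero_le_add {p q : Prop} [Decidable p] [Decidable q] {x : ℝ} (hx : 0 ≤ x) :
    (if p ∧ q then 0 else x) ≤ (if p then 0 else x) + if q then 0 else x := by
  by_cases hp : p <;> by_cases hq : q <;> simp [hp, hq, hx]

lemma l1dist_distr_le [Fintype α] {μ : Ω → ℝ} (hμ : ∀ ω, 0 ≤ μ ω) (X Y : Ω → α) :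
    l1dist (distr μ X) (distr μ Y) ≤ 2 * ∑ ω, if X ω = Y ω then 0 else μ ω := by
  have hpt : ∀ ω, ∑ a, |(if X ω = a then μ ω else 0) - (if Y ω = a then μ ω else 0)| ≤
      2 * if X ω = Y ω then 0 else μ ω := by
    intro ω
    split_ifs with h
    · simp [h]
    · calc ∑ a, |(if X ω = a then μ ω else 0) - (if Y ω = a then μ ω else 0)|
          ≤ ∑ a, ((if X ω = a then μ ω else 0) + (if Y ω = a then μ ω else 0)) := by
            refine sum_le_sum fun a _ => (abs_sub _ _).trans_eq ?_
            congr 1 <;> split_ifs <;> simp [hμ]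
        _ = 2 * μ ω := by
            rw [sum_add_distrib]
            simp
            ring
  calc l1dist (distr μ X) (distr μ Y)
      ≤ ∑ a, ∑ ω, |(if X ω = a then μ ω else 0) - (if Y ω = a then μ ω else 0)| := by
        refine sum_le_sum fun a _ => ?_
        simp only [distr, ← sum_sub_distrib]
        exact abs_sum_le_sum_abs _ _
    _ ≤ 2 * ∑ ω, if X ω = Y ω then 0 else μ ω := by
        rw [sum_comm, mul_sum]
        exact sum_le_sum fun ω _ => hpt ω

end Entropy

section Product

variable {Ω α : Type*} [Fintype Ω]

lemma sum_pi_prod {n : ℕ} (f : Fin n → Ω → ℝ) :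
    ∑ a : Fin n → Ω, ∏ k, f k (a k) = ∏ k, ∑ ω, f k ω :=
  (Fintype.prod_sum f).symm

lemma isPMF_pi {p : Ω → ℝ} (hp : IsPMF p) (n : ℕ) :
    IsPMF fun a : Fin n → Ω => ∏ k, p (a k) := by
  refine ⟨fun a => prod_nonneg fun k _ => hp.1 _, ?_⟩
  rw [sum_pi_prod fun _ => p]
  simp [hp.2]

lemma sum_pi_filter_prod {n : ℕ} (p : Ω → ℝ) (E : Fin n → Ω → Prop)
    [∀ k ω, Decidable (E k ω)] :
    (∑ a : Fin n → Ω, if ∀ k, E k (a k) then ∏ k, p (a k) else 0) =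
      ∏ k, ∑ ω, if E k ω then p ω else 0 := by
  rw [← sum_pi_prod fun k ω => if E k ω then p ω else 0]
  refine sum_congr rfl fun a _ => ?_
  split_ifs with h
  · exact prod_congr rfl fun k _ => by rw [if_pos (h k)]
  · push Not at h
    obtain ⟨k, hk⟩ := h
    exact (prod_eq_zero (mem_univ k) (if_neg hk)).symm

end Product

section SideInformation

variable {A S T : Type*} [Fintype A] [Fintype S] [Fintype T] [DecidableEq S] [DecidableEq T]

/-- The exponential moment governing the error probability is below one for small exponents. -/
lemma exists_exp_moment_lt_one {p : A → ℝ} (hp : ∑ a, p a = 1) (Z : A → ℝ)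
    (hZ : ∑ a, p a * Z a < 0) :
    ∃ t : ℝ, 0 < t ∧ t ≤ 1 ∧ ∑ a, p a * Real.exp (t * Z a) < 1 := by
  have hd : HasDerivAt (fun t : ℝ => ∑ a, p a * Real.exp (t * Z a)) (∑ a, p a * Z a) 0 := by
    refine HasDerivAt.fun_sum fun a _ => HasDerivAt.const_mul (p a) ?_
    simpa using ((hasDerivAt_id (0 : ℝ)).mul_const (Z a)).exp
  have hev := hd.tendsto_slope_zero_right.eventually_lt_const hZ
  have hmem := Ioc_mem_nhdsGT (zero_lt_one' ℝ)
  obtain ⟨t, hlt, ht0, ht1⟩ := (hev.and hmem).exists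
  refine ⟨t, ht0, ht1, ?_⟩
  simp only [zero_add, zero_mul, Real.exp_zero, mul_one, hp, smul_eq_mul] at hlt
  exact sub_neg.1 (neg_of_mul_neg_right hlt (inv_pos.2 ht0).le)

/-- Source coding with decoder side information at any rate above the conditional entropy. -/
lemma exists_source_code_with_side_information {p : A → ℝ} (hp : IsPMF p) (U : A → S)
    (V : A → T) {R : ℝ} (hR : condEnt p V U < R) {ε : ℝ} (hε : 0 < ε) :
    ∃ n₀ : ℕ, ∀ n : ℕ, n₀ ≤ n → ∃ (K : ℕ) (h : (Fin n → T) → Fin K)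
      (D : (Fin n → S) → Fin K → Fin n → T),
      Real.logb 2 K ≤ n * R ∧
      (∑ a : Fin n → A, if D (fun k => U (a k)) (h fun k => V (a k)) = fun k => V (a k)
        then 0 else ∏ k, p (a k)) ≤ ε := by
  obtain ⟨a₀⟩ : Nonempty A := by
    by_contra hne
    rw [not_nonempty_iff] at hne
    simpa using hp.2
  have : Nonempty T := ⟨V a₀⟩
  have hl2 := Real.log_pos one_lt_two
  have hR0 : 0 < R := (condEnt_nonneg hp.1 V U).trans_lt hR
  set W : S → T → ℝ := fun s v => distr p (fun a => (V a, U a)) (v, s) / distr p U s with hW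
  have hW0 : ∀ s v, 0 ≤ W s v := fun s v =>
    div_nonneg (distr_nonneg hp.1 _ _) (distr_nonneg hp.1 _ _)
  have hW1 : ∀ s, ∑ v, W s v ≤ 1 := fun s => by
    simp only [hW, ← sum_div]
    rw [sum_distr_pair p V U s]
    exact div_self_le_one _
  have hWpos : ∀ a, 0 < p a → 0 < W (U a) (V a) := fun a ha =>
    div_pos (ha.trans_le (le_distr_self hp.1 (fun a => (V a, U a)) a))
      (ha.trans_le (le_distr_self hp.1 U a))
  set Z : A → ℝ := fun a => -Real.log (W (U a) (V a)) - R * Real.log 2 with hZ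
  have hZsum : ∑ a, p a * Z a = Real.log 2 * (condEnt p V U - R) := by
    have hR' : R = ∑ a, p a * R := by rw [← sum_mul, hp.2, one_mul]
    rw [condEnt_eq_sum]
    conv_rhs => rw [hR', ← sum_sub_distrib, mul_sum]
    refine sum_congr rfl fun a _ => ?_
    rcases (hp.1 a).eq_or_lt with h | h
    · simp [← h]
    · have h1 := h.trans_le (le_distr_self hp.1 (fun a => (V a, U a)) a)
      have h2 := h.trans_le (le_distr_self hp.1 U a)
      simp only [hZ, hW, Real.logb]
      rw [Real.log_div h1.ne' h2.ne']
      field_simp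
      ring
  obtain ⟨t, ht0, ht1, hr1⟩ := exists_exp_moment_lt_one hp.2 Z
    (hZsum.trans_lt (mul_neg_of_pos_of_neg hl2 (sub_neg.2 hR)))
  set r : ℝ := ∑ a, p a * Real.exp (t * Z a) with hr
  have hr0 : 0 ≤ r := sum_nonneg fun a _ => mul_nonneg (hp.1 a) (Real.exp_pos _).le
  have h2t : (0 : ℝ) < 2 ^ t := by positivity
  obtain ⟨n₀, hn₀⟩ := exists_pow_lt_of_lt_one (div_pos hε h2t) hr1
  refine ⟨n₀, fun n hn => ?_⟩
  have hone : (1 : ℝ) ≤ 2 ^ (n * R) := Real.one_le_rpow one_le_two (by positivity)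
  set K : ℕ := ⌊(2 : ℝ) ^ (n * R)⌋₊ with hKdef
  have hK : 0 < K := Nat.floor_pos.2 hone
  have hK1 : (1 : ℝ) ≤ K := by exact_mod_cast hK
  have hKle : (K : ℝ) ≤ 2 ^ (n * R) := Nat.floor_le (by positivity)
  have hKge : (2 : ℝ) ^ (n * R) ≤ 2 * K := by
    have := Nat.lt_floor_add_one ((2 : ℝ) ^ (n * R))
    linarith
  obtain ⟨h, D, hD⟩ := exists_binning (fun a : Fin n → A => ∏ k, p (a k)) (isPMF_pi hp n).1
    (fun a k => U (a k)) (fun a k => V (a k)) (fun s v => ∏ k, W (s k) (v k))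
    (fun s v => prod_nonneg fun k _ => hW0 _ _)
    (fun s => by
      rw [sum_pi_prod fun k => W (s k)]
      exact prod_le_one (fun k _ => sum_nonneg fun v _ => hW0 _ _) fun k _ => hW1 _)
    (fun a ha => prod_pos fun k _ => hWpos _ <| (hp.1 _).lt_of_ne' fun h0 =>
      ha.ne' (prod_eq_zero (mem_univ k) h0)) hK ht0.le ht1
  refine ⟨K, h, D, ?_, hD.trans ?_⟩
  · calc Real.logb 2 K ≤ Real.logb 2 (2 ^ (n * R)) :=
          Real.logb_le_logb_of_le one_lt_two (by positivity) hKle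
      _ = n * R := Real.logb_rpow two_pos (by norm_num)
  have hterm : ∀ a : Fin n → A,
      (∏ k, p (a k)) * (1 / (K * ∏ k, W (U (a k)) (V (a k)))) ^ t ≤
        2 ^ t * ∏ k, (p (a k) * Real.exp (t * Z (a k))) := by
    intro a
    rw [prod_mul_distrib]
    by_cases h0 : ∃ k, p (a k) = 0
    · obtain ⟨k, hk⟩ := h0
      simp [prod_eq_zero (f := fun k => p (a k)) (mem_univ k) hk]
    push Not at h0
    have hwp : ∀ k, 0 < W (U (a k)) (V (a k)) := fun k =>
      hWpos _ ((hp.1 _).lt_of_ne' (h0 k))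
    have hwprod : 0 < ∏ k, W (U (a k)) (V (a k)) := prod_pos fun k _ => hwp k
    have hexp : ∏ k, Real.exp (Z (a k)) =
        1 / (2 ^ (n * R) * ∏ k, W (U (a k)) (V (a k))) := by
      have hk : ∀ k, Real.exp (Z (a k)) = (W (U (a k)) (V (a k)))⁻¹ * ((2 : ℝ) ^ R)⁻¹ := by
        intro k
        simp only [hZ]
        rw [sub_eq_add_neg, Real.exp_add, Real.exp_neg, Real.exp_log (hwp k), Real.exp_neg,
          Real.rpow_def_of_pos two_pos, mul_comm R]
      simp only [hk, prod_mul_distrib, prod_inv_distrib, prod_const, card_univ, Fintype.card_fin]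
      rw [mul_comm (n : ℝ) R, Real.rpow_mul two_pos.le, Real.rpow_natCast, one_div, mul_inv,
        mul_comm]
    have hbase : 1 / (K * ∏ k, W (U (a k)) (V (a k))) ≤ 2 * ∏ k, Real.exp (Z (a k)) := by
      rw [hexp, mul_one_div, div_le_div_iff₀ (by positivity) (by positivity), one_mul,
        ← mul_assoc]
      gcongr
    have hpow : (2 * ∏ k, Real.exp (Z (a k))) ^ t = 2 ^ t * ∏ k, Real.exp (t * Z (a k)) := by
      rw [Real.mul_rpow two_pos.le (prod_nonneg fun k _ => (Real.exp_pos _).le),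
        ← Real.finsetProd_rpow _ _ fun k _ => (Real.exp_pos _).le]
      simp only [← Real.exp_mul, mul_comm t]
    calc (∏ k, p (a k)) * (1 / (K * ∏ k, W (U (a k)) (V (a k)))) ^ t
        ≤ (∏ k, p (a k)) * (2 * ∏ k, Real.exp (Z (a k))) ^ t := by
          gcongr
          exact prod_nonneg fun k _ => hp.1 _
      _ = 2 ^ t * ((∏ k, p (a k)) * ∏ k, Real.exp (t * Z (a k))) := by
          rw [hpow]
          ring
  calc (∑ a : Fin n → A, (∏ k, p (a k)) * (1 / (K * ∏ k, W (U (a k)) (V (a k)))) ^ t)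
      ≤ ∑ a : Fin n → A, 2 ^ t * ∏ k, (p (a k) * Real.exp (t * Z (a k))) :=
        sum_le_sum fun a _ => hterm a
    _ = 2 ^ t * r ^ n := by
        rw [← mul_sum, sum_pi_prod fun _ a => p a * Real.exp (t * Z a)]
        simp [hr]
    _ ≤ 2 ^ t * r ^ n₀ := by
        gcongr 2 ^ t * ?_
        exact pow_le_pow_of_le_one hr0 hr1.le hn
    _ ≤ ε := by
        rw [lt_div_iff₀ h2t] at hn₀
        linarith

end SideInformation

/-- the Slepian–Wolf observation. Suppose that under `q` we have
`H(Y¹ | X²) = 0` and `H(Y² | X¹) = 0`. Then every rate pair `(R12, R21)` with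
`R12 > H_q(Y² | X²)` and `R21 > H_q(Y¹ | X¹)` is admissible for `q` with two rounds
of communication. The entropies are computed with `q` itself as the underlying pmf and
the coordinate projections as random variables (`a.1 = x¹`, `a.2.1 = x²`,
`a.2.2.1 = y¹`, `a.2.2.2 = y²`). -/
theorem slepian_wolf_achievability
    [Fintype 𝒳₁] [DecidableEq 𝒳₁] [Fintype 𝒳₂] [DecidableEq 𝒳₂]
    [Fintype 𝒴₁] [DecidableEq 𝒴₁] [Fintype 𝒴₂] [DecidableEq 𝒴₂]
    (q : 𝒳₁ × 𝒳₂ × 𝒴₁ × 𝒴₂ → ℝ) (hq : IsPMF q)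
    (h1 : condEnt q (fun a => a.2.2.1) (fun a => a.2.1) = 0)
    (h2 : condEnt q (fun a => a.2.2.2) (fun a => a.1) = 0)
    (R12 R21 : ℝ)
    (hR12 : R12 > condEnt q (fun a => a.2.2.2) (fun a => a.2.1))
    (hR21 : R21 > condEnt q (fun a => a.2.2.1) (fun a => a.1)) :
    Admissible q 2 R12 R21 := by
  intro ε hε
  obtain ⟨ω₀⟩ : Nonempty (𝒳₁ × 𝒳₂ × 𝒴₁ × 𝒴₂) := by
    by_contra hne
    rw [not_nonempty_iff] at hne
    simpa using hq.2
  have : Nonempty 𝒴₁ := ⟨ω₀.2.2.1⟩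
  have : Nonempty 𝒴₂ := ⟨ω₀.2.2.2⟩
  obtain ⟨f, hf⟩ := exists_fun_of_condEnt_eq_zero hq.1 h1
  obtain ⟨g, hg⟩ := exists_fun_of_condEnt_eq_zero hq.1 h2
  have hε4 : 0 < ε / 4 := by positivity
  obtain ⟨na, hna⟩ := exists_source_code_with_side_information hq (fun a => a.2.1)
    (fun a => a.2.2.2) hR12 hε4
  obtain ⟨nb, hnb⟩ := exists_source_code_with_side_information hq (fun a => a.1)
    (fun a => a.2.2.1) hR21 hε4
  refine ⟨max na nb, fun n hn => ?_⟩
  obtain ⟨Ka, ha, Da, hKa, hea⟩ := hna n (le_of_max_le_left hn)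
  obtain ⟨Kb, hb, Db, hKb, heb⟩ := hnb n (le_of_max_le_right hn)
  set μ : (Fin n → 𝒳₁ × 𝒳₂ × 𝒴₁ × 𝒴₂) → ℝ := fun a => ∏ k, q (a k) with hμ_def
  have hμ : IsPMF μ := isPMF_pi hq n
  obtain ⟨C, hC0, hC1⟩ : ∃ C : (i : Fin 2) → (Fin n → 𝒳₁ × 𝒳₂ × 𝒴₁ × 𝒴₂) → Fin (![Ka, Kb] i),
      (∀ a, C 0 a = ha fun k => g (a k).1) ∧ ∀ a, C 1 a = hb fun k => f (a k).2.1 :=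
    ⟨fun i => match i with
      | 0 => fun a => ha fun k => g (a k).1
      | 1 => fun a => hb fun k => f (a k).2.1, fun _ => rfl, fun _ => rfl⟩
  refine ⟨Fin n → 𝒳₁ × 𝒳₂ × 𝒴₁ × 𝒴₂, Unit, Unit, fun i => Fin (![Ka, Kb] i),
    inferInstance, inferInstance, inferInstance, inferInstance, inferInstance, inferInstance,
    inferInstance, inferInstance, μ, fun a k => (a k).1, fun a k => (a k).2.1,
    fun _ => (), fun _ => (), C,
    fun a => Db (fun k => (a k).1) (hb fun k => f (a k).2.1),
    fun a => Da (fun k => (a k).2.1) (ha fun k => g (a k).1),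
    hμ, ?_, ?_, ?_, ?_, ?_, ?_, ?_, ?_, ?_⟩
  · funext x
    have := sum_pi_filter_prod q fun (k : Fin n) a => a.1 = x.1 k ∧ a.2.1 = x.2 k
    simp only [forall_and] at this
    simp only [distr, hμ_def, Prod.ext_iff, funext_iff]
    rw [this]
    refine prod_congr rfl fun k _ => ?_
    simp [srcMarg, Fintype.sum_prod_type, ite_and]
    rw [sum_eq_single (x.2 k)] <;> simp +contextual
  · funext m
    have hM : distr μ (fun _ => ()) () = 1 := by simpa [distr] using hμ.2
    rw [hM, one_mul, one_mul]
    simp [distr, Prod.ext_iff]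
  · intro i hi
    fin_cases i
    · exact condEnt_eq_zero_of_eq_comp μ (fun z => ha fun k => g (z.2.1 k)) hC0
    · simp at hi
  · intro i hi
    fin_cases i
    · simp at hi
    · exact condEnt_eq_zero_of_eq_comp μ (fun z => hb fun k => f (z.2.1 k)) hC1
  · have h0 : ({i : Fin 2 | (i : ℕ) % 2 = 0} : Finset (Fin 2)) = {0} := by decide
    rw [h0, sum_singleton]
    refine (H_le_logb_card hμ _).trans ?_
    exact (congrArg (fun m : ℕ => Real.logb 2 m) (Fintype.card_fin Ka)).trans_le hKa
  · have h0 : ({i : Fin 2 | (i : ℕ) % 2 = 1} : Finset (Fin 2)) = {1} := by decide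
    rw [h0, sum_singleton]
    refine (H_le_logb_card hμ _).trans ?_
    exact (congrArg (fun m : ℕ => Real.logb 2 m) (Fintype.card_fin Kb)).trans_le hKb
  · exact condEnt_eq_zero_of_eq_comp μ (fun z => Db z.1 (z.2.2 1)) fun a =>
      congrArg (Db fun k => (a k).1) (hC1 a).symm
  · exact condEnt_eq_zero_of_eq_comp μ (fun z => Da z.1 (z.2.2 0)) fun a =>
      congrArg (Da fun k => (a k).2.1) (hC0 a).symm
  · have htarget : (fun a : (Fin n → 𝒳₁) × (Fin n → 𝒳₂) × (Fin n → 𝒴₁) × (Fin n → 𝒴₂) =>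
        ∏ k, q (a.1 k, a.2.1 k, a.2.2.1 k, a.2.2.2 k)) =
        distr μ fun a => (fun k => (a k).1, fun k => (a k).2.1, fun k => (a k).2.2.1,
          fun k => (a k).2.2.2) := by
      funext x
      have hsingle : ∏ k, q (x.1 k, x.2.1 k, x.2.2.1 k, x.2.2.2 k) =
          ∏ k, ∑ a, if a = (x.1 k, x.2.1 k, x.2.2.1 k, x.2.2.2 k) then q a else 0 := by simp
      rw [hsingle, ← sum_pi_filter_prod]
      exact sum_congr rfl fun a _ => if_congr
        (by simp only [Prod.ext_iff, funext_iff, forall_and]) rfl rfl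
    rw [htarget]
    refine (l1dist_distr_le hμ.1 _ _).trans ?_
    have hle := add_le_add heb hea
    rw [← sum_add_distrib] at hle
    refine (mul_le_mul_of_nonneg_left ((sum_le_sum fun a _ => ?_).trans hle) two_pos.le).trans
      (by linarith)
    rcases (hμ.1 a).eq_or_lt with h0 | h0
    · have h0' : ∏ k, q (a k) = 0 := h0.symm
      simp [← h0, h0']
    have hqa : ∀ k, 0 < q (a k) := fun k => (hq.1 _).lt_of_ne' fun hk =>
      h0.ne' (prod_eq_zero (mem_univ k) hk)
    simp only [hf _ (hqa _), hg _ (hqa _), Prod.mk.injEq, true_and]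
    exact ite_and_zero_le_add (hμ.1 a)

end Coord
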